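/- arXiv:2105.14611 — 2 statements merged into one kernel-verified Lean document; each statement's English description precedes it below -/
import Mathlib

section
/- Let λ > 0, let the weights ψ be symmetric (ψ_{ij} = ψ_{ji}) and bi-stochastic, and let x be a solution of the reaction-delay system. Set ε := 2λ, δ := (1+2λ)τ, and define the functional L(t) := (1/2) Σ_{i=1}^N |x_i(t) − λτ Φ^i(t−τ)|² + (λ²τ²/δ)(1+ε^{−1}) ∫_{t−τ}^t Σ_{i=1}^N |Φ^i(s−τ)|² ds + ((1+ε)τ/(2δ)) ∫_{t−τ}^t ∫_θ^t D(s−τ) ds dθ. Then for every t > τ, L is differentiable at t and L'(t) ≤ ( (1+λ)τ − 1/2 ) D(t−τ). -/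
open Finset

/-- `Φ^i(t) = Σ_j ψ_{ij} (x_j(t) - x_i(t))`. -/
noncomputable def Phi {N d : ℕ} (ψ : Fin N → Fin N → ℝ)
    (x : Fin N → ℝ → EuclideanSpace ℝ (Fin d)) (i : Fin N) (t : ℝ) : EuclideanSpace ℝ (Fin d) :=
  ∑ j : Fin N, ψ i j • (x j t - x i t)

/-- `D(t) = Σ_i Σ_j ψ_{ij} |x_j(t) - x_i(t)|²`. -/
noncomputable def Dquad {N d : ℕ} (ψ : Fin N → Fin N → ℝ)
    (x : Fin N → ℝ → EuclideanSpace ℝ (Fin d)) (t : ℝ) : ℝ :=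
  ∑ i : Fin N, ∑ j : Fin N, ψ i j * ‖x j t - x i t‖ ^ 2

theorem hasDerivAt_integral_window {f : ℝ → ℝ} (hf : Continuous f) (τ t : ℝ) :
    HasDerivAt (fun u => ∫ s in (u - τ)..u, f s) (f t - f (t - τ)) t := by
  have hF : ∀ u, HasDerivAt (fun u => ∫ s in (0 : ℝ)..u, f s) (f u) u := fun u =>
    hf.integral_hasStrictDerivAt 0 u |>.hasDerivAt
  have hshift : HasDerivAt (fun u => ∫ s in (0 : ℝ)..(u - τ), f s) (f (t - τ)) t :=
    (hF (t - τ)).comp_sub_const t τ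
  refine ((hF t).sub hshift).congr_of_eventuallyEq (Filter.Eventually.of_forall fun u => ?_)
  exact (intervalIntegral.integral_interval_sub_left
    (hf.intervalIntegrable _ _) (hf.intervalIntegrable _ _)).symm

theorem hasDerivAt_iterated_integral_window {f : ℝ → ℝ} (hf : Continuous f) (τ t : ℝ) :
    HasDerivAt (fun u => ∫ θ in (u - τ)..u, ∫ s in θ..u, f s)
      (τ * f t - ∫ s in (t - τ)..t, f s) t := by
  have hF : ∀ u, HasDerivAt (fun u => ∫ s in (0 : ℝ)..u, f s) (f u) u := fun u =>
    hf.integral_hasStrictDerivAt 0 u |>.hasDerivAt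
  have hFc : Continuous (fun u => ∫ s in (0 : ℝ)..u, f s) :=
    continuous_iff_continuousAt.2 fun u => (hF u).continuousAt
  have hsub : ∀ a b, ∫ s in a..b, f s = (∫ s in (0 : ℝ)..b, f s) - ∫ s in (0 : ℝ)..a, f s :=
    fun a b => (intervalIntegral.integral_interval_sub_left
      (hf.intervalIntegrable _ _) (hf.intervalIntegrable _ _)).symm
  have h := ((hF t).const_mul τ).sub (hasDerivAt_integral_window hFc τ t)
  rw [← hsub] at h
  refine h.congr_of_eventuallyEq (Filter.Eventually.of_forall fun u => ?_)
  dsimp only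
  rw [intervalIntegral.integral_congr fun θ _ => hsub θ u]
  rw [intervalIntegral.integral_sub (continuous_const.intervalIntegrable _ _)
    (hFc.intervalIntegrable _ _), intervalIntegral.integral_const]
  simp

section Weights

variable {N d : ℕ} {ψ : Fin N → Fin N → ℝ} {x : Fin N → ℝ → EuclideanSpace ℝ (Fin d)}

theorem continuous_Phi (hx : ∀ i, Continuous (x i)) (i : Fin N) : Continuous (Phi ψ x i) := by
  unfold Phi
  fun_prop

theorem continuous_Dquad (hx : ∀ i, Continuous (x i)) : Continuous (Dquad ψ x) := by
  unfold Dquad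
  fun_prop

theorem Phi_congr {y : Fin N → ℝ → EuclideanSpace ℝ (Fin d)} {t : ℝ}
    (h : ∀ i, x i t = y i t) (i : Fin N) : Phi ψ x i t = Phi ψ y i t := by
  simp only [Phi, h]

theorem Dquad_congr {y : Fin N → ℝ → EuclideanSpace ℝ (Fin d)} {t : ℝ}
    (h : ∀ i, x i t = y i t) : Dquad ψ x t = Dquad ψ y t := by
  simp only [Dquad, h]

theorem hasDerivAt_Phi {v : Fin N → EuclideanSpace ℝ (Fin d)} {t : ℝ}
    (h : ∀ i, HasDerivAt (x i) (v i) t) (i : Fin N) :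
    HasDerivAt (Phi ψ x i) (∑ j, ψ i j • (v j - v i)) t := by
  unfold Phi
  exact HasDerivAt.fun_sum fun j _ => ((h j).sub (h i)).const_smul (ψ i j)

theorem sum_inner_Phi (hsymm : ∀ i j, ψ i j = ψ j i) (t : ℝ) :
    ∑ i, inner ℝ (x i t) (Phi ψ x i t) = -(1 / 2) * Dquad ψ x t := by
  have hleft : ∑ i, inner ℝ (x i t) (Phi ψ x i t) =
      ∑ i, ∑ j, ψ i j * inner ℝ (x i t) (x j t - x i t) := by
    simp only [Phi, inner_sum, inner_smul_right]
  have hswap : ∑ i, inner ℝ (x i t) (Phi ψ x i t) =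
      ∑ i, ∑ j, ψ i j * inner ℝ (x j t) (x i t - x j t) := by
    rw [hleft, Finset.sum_comm]
    exact Finset.sum_congr rfl fun i _ => Finset.sum_congr rfl fun j _ => by rw [hsymm i j]
  have hadd : (∑ i, ∑ j, ψ i j * inner ℝ (x i t) (x j t - x i t)) +
      ∑ i, ∑ j, ψ i j * inner ℝ (x j t) (x i t - x j t) = -Dquad ψ x t := by
    simp only [Dquad, ← Finset.sum_add_distrib, ← Finset.sum_neg_distrib]
    refine Finset.sum_congr rfl fun i _ => Finset.sum_congr rfl fun j _ => ?_
    rw [← real_inner_self_eq_norm_sq]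
    simp only [inner_sub_left, inner_sub_right, real_inner_comm (x i t) (x j t)]
    ring
  linarith

theorem sum_norm_Phi_sq_le (hnonneg : ∀ i j, 0 ≤ ψ i j) (hstoch : ∀ i, ∑ j, ψ i j = 1) (t : ℝ) :
    ∑ i, ‖Phi ψ x i t‖ ^ 2 ≤ Dquad ψ x t := by
  refine Finset.sum_le_sum fun i _ => ?_
  have hconv : ConvexOn ℝ Set.univ fun v : EuclideanSpace ℝ (Fin d) => ‖v‖ ^ 2 :=
    convexOn_univ_norm.pow (fun v _ => norm_nonneg v) 2
  exact hconv.map_sum_le (fun j _ => hnonneg i j) (hstoch i) fun _ _ => Set.mem_univ _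

end Weights

theorem inner_intervalIntegral_le {E : Type*} [NormedAddCommGroup E] [InnerProductSpace ℝ E]
    [CompleteSpace E] {f : ℝ → E} (hf : Continuous f) (v : E) {a b : ℝ} (hab : a ≤ b) :
    inner ℝ (∫ s in a..b, f s) v ≤
      (1 / 2) * (∫ s in a..b, ‖f s‖ ^ 2) + (b - a) / 2 * ‖v‖ ^ 2 := by
  have hcomm : inner ℝ (∫ s in a..b, f s) v = ∫ s in a..b, inner ℝ v (f s) := by
    rw [real_inner_comm]
    exact ((innerSL ℝ v).intervalIntegral_comp_comm (hf.intervalIntegrable a b)).symm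
  have hrhs : (1 / 2) * (∫ s in a..b, ‖f s‖ ^ 2) + (b - a) / 2 * ‖v‖ ^ 2 =
      ∫ s in a..b, ((1 / 2) * ‖f s‖ ^ 2 + (1 / 2) * ‖v‖ ^ 2) := by
    rw [intervalIntegral.integral_add (Continuous.intervalIntegrable (by fun_prop) _ _)
      (Continuous.intervalIntegrable (by fun_prop) _ _), intervalIntegral.integral_const_mul,
      intervalIntegral.integral_const, smul_eq_mul]
    ring
  rw [hcomm, hrhs]
  refine intervalIntegral.integral_mono_on hab
    (Continuous.intervalIntegrable (by fun_prop) _ _)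
    (Continuous.intervalIntegrable (by fun_prop) _ _) fun s _ => ?_
  have h := norm_sub_sq_real v (f s)
  nlinarith [sq_nonneg ‖v - f s‖]

/-- Dissipation of the functional, with its coefficients simplified, along a solution that is
continuous on the whole line. -/
theorem hasDerivAt_lyapunov_of_continuous {N d : ℕ} {τ lam : ℝ} (hτ : 0 < τ) (hlam : 0 < lam)
    {ψ : Fin N → Fin N → ℝ} (hsymm : ∀ i j, ψ i j = ψ j i) (hnonneg : ∀ i j, 0 ≤ ψ i j)
    (hstoch : ∀ i, ∑ j, ψ i j = 1) {x xd : Fin N → ℝ → EuclideanSpace ℝ (Fin d)}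
    (hx : ∀ i, Continuous (x i)) (hderiv : ∀ i, ∀ t > -τ, HasDerivAt (x i) (xd i t) t)
    (hode : ∀ t > (0 : ℝ), ∀ i, xd i t = ∑ j, ψ i j •
      (x j (t - τ) + (lam * τ) • xd j (t - τ) - x i (t - τ) - (lam * τ) • xd i (t - τ)))
    {t : ℝ} (ht : τ < t) :
    ∃ L' : ℝ, HasDerivAt (fun u =>
        (1 / 2) * ∑ i, ‖x i u - (lam * τ) • Phi ψ x i (u - τ)‖ ^ 2 +
          (lam * τ / 2) * (∫ s in (u - τ)..u, ∑ i, ‖Phi ψ x i (s - τ)‖ ^ 2) +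
          (1 / 2) * ∫ θ in (u - τ)..u, ∫ s in θ..u, Dquad ψ x (s - τ)) L' t ∧
      L' ≤ ((1 + lam) * τ - 1 / 2) * Dquad ψ x (t - τ) := by
  have hPhi := fun i => continuous_Phi (ψ := ψ) hx i
  have hPhiτ : ∀ i, Continuous fun s => Phi ψ x i (s - τ) := fun i =>
    (hPhi i).comp (continuous_sub_right τ)
  have hDτ : Continuous fun s => Dquad ψ x (s - τ) :=
    (continuous_Dquad hx).comp (continuous_sub_right τ)
  have hy : ∀ i, ∀ s > 0, HasDerivAt (fun u => x i u - (lam * τ) • Phi ψ x i (u - τ))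
      (Phi ψ x i (s - τ)) s := by
    intro i s hs
    have h := (hderiv i s (by linarith)).sub (((hasDerivAt_Phi (ψ := ψ)
      (fun j => hderiv j (s - τ) (by linarith)) i).comp_sub_const s τ).const_smul (lam * τ))
    refine h.congr_deriv ?_
    rw [hode s hs i, Phi, Finset.smul_sum, ← Finset.sum_sub_distrib]
    refine Finset.sum_congr rfl fun j _ => ?_
    module
  have hint : ∀ i, x i t - (lam * τ) • Phi ψ x i (t - τ) = x i (t - τ) +
      (∫ s in (t - τ)..t, Phi ψ x i (s - τ)) - (lam * τ) • Phi ψ x i (t - τ - τ) := by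
    intro i
    rw [intervalIntegral.integral_eq_sub_of_hasDerivAt (fun s hs => hy i s ?_)
      ((hPhiτ i).intervalIntegrable _ _)]
    · abel
    · rw [Set.uIcc_of_le (by linarith)] at hs
      linarith [hs.1]
  have hnorm : Continuous fun s => ∑ i, ‖Phi ψ x i (s - τ)‖ ^ 2 := by fun_prop
  have hderiv_sq := (HasDerivAt.fun_sum (u := Finset.univ)
    fun i _ => (hy i t (by linarith)).norm_sq).const_mul (1 / 2 : ℝ)
  refine ⟨_, (hderiv_sq.add ((hasDerivAt_integral_window hnorm τ t).const_mul (lam * τ / 2))).add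
    ((hasDerivAt_iterated_integral_window hDτ τ t).const_mul (1 / 2)), ?_⟩
  have hsplit : (1 / 2 : ℝ) * ∑ i, 2 * inner ℝ (x i t - (lam * τ) • Phi ψ x i (t - τ))
      (Phi ψ x i (t - τ)) = -(1 / 2) * Dquad ψ x (t - τ) +
      (∑ i, inner ℝ (∫ s in (t - τ)..t, Phi ψ x i (s - τ)) (Phi ψ x i (t - τ))) -
      lam * τ * ∑ i, inner ℝ (Phi ψ x i (t - τ - τ)) (Phi ψ x i (t - τ)) := by
    rw [← sum_inner_Phi hsymm, ← Finset.mul_sum, ← mul_assoc]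
    simp only [hint, inner_sub_left, inner_add_left, Finset.sum_sub_distrib,
      Finset.sum_add_distrib, real_inner_smul_left, Finset.mul_sum]
    norm_num
  have hdelay : ∑ i, inner ℝ (∫ s in (t - τ)..t, Phi ψ x i (s - τ)) (Phi ψ x i (t - τ)) ≤
      (1 / 2) * (∫ s in (t - τ)..t, Dquad ψ x (s - τ)) +
        τ / 2 * ∑ i, ‖Phi ψ x i (t - τ)‖ ^ 2 := by
    have hsum : ∫ s in (t - τ)..t, ∑ i, ‖Phi ψ x i (s - τ)‖ ^ 2 =
        ∑ i, ∫ s in (t - τ)..t, ‖Phi ψ x i (s - τ)‖ ^ 2 :=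
      intervalIntegral.integral_finsetSum fun i _ =>
        ((hPhiτ i).norm.pow 2).intervalIntegrable _ _
    have hmono : ∫ s in (t - τ)..t, ∑ i, ‖Phi ψ x i (s - τ)‖ ^ 2 ≤
        ∫ s in (t - τ)..t, Dquad ψ x (s - τ) :=
      intervalIntegral.integral_mono_on (by linarith) (hnorm.intervalIntegrable _ _)
        (hDτ.intervalIntegrable _ _) fun s _ => sum_norm_Phi_sq_le hnonneg hstoch (s - τ)
    have hyoung := Finset.sum_le_sum fun i (_ : i ∈ Finset.univ) =>
      inner_intervalIntegral_le (hPhiτ i) (Phi ψ x i (t - τ)) (show t - τ ≤ t by linarith)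
    rw [Finset.sum_add_distrib, ← Finset.mul_sum, ← Finset.mul_sum, ← hsum,
      sub_sub_cancel] at hyoung
    linarith
  have hcross : -∑ i, inner ℝ (Phi ψ x i (t - τ - τ)) (Phi ψ x i (t - τ)) ≤
      (1 / 2) * (∑ i, ‖Phi ψ x i (t - τ)‖ ^ 2) +
        (1 / 2) * ∑ i, ‖Phi ψ x i (t - τ - τ)‖ ^ 2 := by
    rw [← Finset.sum_neg_distrib, Finset.mul_sum, Finset.mul_sum, ← Finset.sum_add_distrib]
    refine Finset.sum_le_sum fun i _ => ?_
    have h := norm_add_sq_real (Phi ψ x i (t - τ - τ)) (Phi ψ x i (t - τ))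
    nlinarith [sq_nonneg ‖Phi ψ x i (t - τ - τ) + Phi ψ x i (t - τ)‖]
  have hD := sum_norm_Phi_sq_le (x := x) hnonneg hstoch (t - τ)
  have hlt : 0 < lam * τ := mul_pos hlam hτ
  rw [hsplit]
  have h1 := mul_le_mul_of_nonneg_left hcross hlt.le
  have h2 := mul_le_mul_of_nonneg_left hD hlt.le
  have h3 := mul_le_mul_of_nonneg_left hD hτ.le
  linarith

/-- **Dissipation of the Lyapunov functional for the reaction-type delay system**
(Lemma 5.2 of the paper), with the optimal choices `ε = 2λ`, `δ = (1+2λ)τ`. -/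
theorem reaction_delay_lyapunov_dissipation {N d : ℕ} (hN : 2 ≤ N) (hd : 1 ≤ d)
    (τ lam : ℝ) (hτ : 0 < τ) (hlam : 0 < lam)
    (ψ : Fin N → Fin N → ℝ)
    (hψsymm : ∀ i j : Fin N, ψ i j = ψ j i)
    (hψnonneg : ∀ i j : Fin N, 0 ≤ ψ i j)
    (hψstoch : ∀ i : Fin N, ∑ j : Fin N, ψ i j = 1)
    (x xd : Fin N → ℝ → EuclideanSpace ℝ (Fin d))
    (hderiv : ∀ i, ∀ t ∈ Set.Ici (-τ), HasDerivWithinAt (x i) (xd i t) (Set.Ici (-τ)) t)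
    (hcont : ∀ i, ContinuousOn (xd i) (Set.Ici (-τ)))
    (hode : ∀ t > (0 : ℝ), ∀ i, xd i t =
      ∑ j : Fin N, ψ i j •
        (x j (t - τ) + (lam * τ) • xd j (t - τ) - x i (t - τ) - (lam * τ) • xd i (t - τ)))
    (ε δ : ℝ) (hε : ε = 2 * lam) (hδ : δ = (1 + 2 * lam) * τ)
    (L : ℝ → ℝ)
    (hL : ∀ t, L t =
      (1 / 2) * ∑ i : Fin N, ‖x i t - (lam * τ) • Phi ψ x i (t - τ)‖ ^ 2 +
        (lam ^ 2 * τ ^ 2 / δ) * (1 + ε⁻¹) *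
          (∫ s in (t - τ)..t, ∑ i : Fin N, ‖Phi ψ x i (s - τ)‖ ^ 2) +
        ((1 + ε) * τ / (2 * δ)) * ∫ θ in (t - τ)..t, ∫ s in θ..t, Dquad ψ x (s - τ)) :
    ∀ t > τ, ∃ L' : ℝ, HasDerivAt L L' t ∧
      L' ≤ ((1 + lam) * τ - 1 / 2) * Dquad ψ x (t - τ) := by
  intro t ht
  set g : Fin N → ℝ → EuclideanSpace ℝ (Fin d) := fun i u => x i (max u (-τ)) with hg
  have hgx : ∀ u ≥ -τ, ∀ i, x i u = g i u := fun u hu i => by simp only [hg, max_eq_left hu]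
  have hgc : ∀ i, Continuous (g i) := fun i =>
    ContinuousOn.comp_continuous (fun u hu => (hderiv i u hu).continuousWithinAt)
      (by fun_prop) fun u => le_max_right u (-τ)
  have hgd : ∀ i, ∀ u > -τ, HasDerivAt (g i) (xd i u) u := by
    intro i u hu
    refine ((hderiv i u hu.le).hasDerivAt (Ici_mem_nhds hu)).congr_of_eventuallyEq ?_
    filter_upwards [Ici_mem_nhds hu] with v hv using (hgx v hv i).symm
  have hgode : ∀ u > (0 : ℝ), ∀ i, xd i u = ∑ j, ψ i j •
      (g j (u - τ) + (lam * τ) • xd j (u - τ) - g i (u - τ) - (lam * τ) • xd i (u - τ)) := by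
    intro u hu i
    simp only [hode u hu i, hgx (u - τ) (by linarith)]
  obtain ⟨L', hL', hle⟩ :=
    hasDerivAt_lyapunov_of_continuous hτ hlam hψsymm hψnonneg hψstoch hgc hgd hgode ht
  refine ⟨L', hL'.congr_of_eventuallyEq ?_, ?_⟩
  · have hc₁ : (lam ^ 2 * τ ^ 2 / δ) * (1 + ε⁻¹) = lam * τ / 2 := by
      subst hε hδ
      field_simp
      ring
    have hc₂ : (1 + ε) * τ / (2 * δ) = 1 / 2 := by
      subst hε hδ
      field_simp
    filter_upwards [Ioi_mem_nhds ht] with u hu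
    have hu' : τ < u := hu
    rw [hL u, hc₁, hc₂]
    congr 1
    · congr 1
      · simp only [hgx u (by linarith), Phi_congr (hgx (u - τ) (by linarith))]
      · congr 1
        refine intervalIntegral.integral_congr fun s hs => ?_
        rw [Set.uIcc_of_le (by linarith)] at hs
        simp only [Phi_congr (hgx (s - τ) (by linarith [hs.1]))]
    · congr 1
      refine intervalIntegral.integral_congr fun θ hθ => ?_
      rw [Set.uIcc_of_le (by linarith)] at hθ
      refine intervalIntegral.integral_congr fun s hs => ?_
      rw [Set.uIcc_of_le hθ.2] at hs
      exact Dquad_congr (hgx (s - τ) (by linarith [hs.1, hθ.1]))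
  · rwa [Dquad_congr (hgx (t - τ) (by linarith))]
end

section
/- Let the weights ψ be row-stochastic with nonnegative entries, let λτ ≤ 1, and let x be a solution of the transmission-delay system. Set M := max_{t ∈ [−τ,0]} max_{i ∈ [N]} max{ |x_i(t)|, |x_i'(t)| }. Then the function t ↦ d_x(t)² is Lipschitz continuous on [0, ∞) with Lipschitz constant 24(1+λτ)² M², i.e., |d_x(t)² − d_x(s)²| ≤ 24(1+λτ)² M² |t − s| for all t, s ≥ 0. -/
open Finset

/-- The maximum opinion discord `d_x(t) = max_{i,j} |x_i(t) - x_j(t)|`. -/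
noncomputable def maxDiscord {N d : ℕ} (x : Fin N → ℝ → EuclideanSpace ℝ (Fin d)) (t : ℝ) : ℝ :=
  ⨆ p : Fin N × Fin N, ‖x p.1 t - x p.2 t‖

/-- A curve relaxing exponentially towards a forcing term of norm at most `R` stays in the ball of
radius `R`. -/
theorem norm_le_of_norm_add_deriv_le {E : Type*} [NormedAddCommGroup E] [NormedSpace ℝ E]
    {f f' : ℝ → E} {a b R : ℝ} (hab : a ≤ b)
    (hf : ∀ t ∈ Set.Icc a b, HasDerivWithinAt f (f' t) (Set.Ici t) t)
    (hfc : ContinuousOn f (Set.Icc a b)) (hf'c : ContinuousOn f' (Set.Icc a b))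
    (ha : ‖f a‖ ≤ R) (hR : ∀ t ∈ Set.Ioc a b, ‖f t + f' t‖ ≤ R) : ‖f b‖ ≤ R := by
  rcases hab.eq_or_lt with rfl | hlt
  · exact ha
  have hR' : ∀ t ∈ Set.Icc a b, ‖f t + f' t‖ ≤ R := by
    intro t ht
    rw [← closure_Ioc hlt.ne] at ht hfc hf'c
    exact le_on_closure hR (hfc.add hf'c).norm continuousOn_const ht
  have key : ‖Real.exp b • f b‖ ≤ R * Real.exp b := by
    refine image_norm_le_of_norm_deriv_right_le_deriv_boundary (a := a) (b := b)
      (f := fun s => Real.exp s • f s) (f' := fun s => Real.exp s • f' s + Real.exp s • f s)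
      (B := fun s => R * Real.exp s) (B' := fun s => R * Real.exp s)
      (Real.continuous_exp.continuousOn.smul hfc) ?_ ?_ ?_ ?_ (Set.right_mem_Icc.2 hab)
    · intro s hs
      exact (Real.hasDerivAt_exp s).hasDerivWithinAt.smul (hf s (Set.Ico_subset_Icc_self hs))
    · rw [norm_smul, Real.norm_of_nonneg (Real.exp_nonneg a), mul_comm]
      exact mul_le_mul_of_nonneg_right ha (Real.exp_nonneg a)
    · intro s
      exact (Real.hasDerivAt_exp s).const_mul R
    · intro s hs
      rw [← smul_add, norm_smul, Real.norm_of_nonneg (Real.exp_nonneg s), mul_comm, add_comm (f' s)]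
      exact mul_le_mul_of_nonneg_right (hR' s (Set.Ico_subset_Icc_self hs)) (Real.exp_nonneg s)
  rw [norm_smul, Real.norm_of_nonneg (Real.exp_nonneg b), mul_comm] at key
  exact le_of_mul_le_mul_right key (Real.exp_pos b)

/-- A convex combination of vectors of norm at most `R` has norm at most `R`. -/
theorem norm_sum_smul_le_of_sum_eq_one {ι E : Type*} [NormedAddCommGroup E] [NormedSpace ℝ E]
    {s : Finset ι} {w : ι → ℝ} {v : ι → E} {R : ℝ} (hw : ∀ j ∈ s, 0 ≤ w j)
    (hsum : ∑ j ∈ s, w j = 1) (hv : ∀ j ∈ s, ‖v j‖ ≤ R) : ‖∑ j ∈ s, w j • v j‖ ≤ R := by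
  have h := (convex_closedBall (0 : E) R).sum_mem hw hsum
    (fun j hj => mem_closedBall_zero_iff.2 (hv j hj))
  exact mem_closedBall_zero_iff.1 h

theorem norm_sub_le_maxDiscord {N d : ℕ} (x : Fin N → ℝ → EuclideanSpace ℝ (Fin d)) (t : ℝ)
    (i j : Fin N) : ‖x i t - x j t‖ ≤ maxDiscord x t :=
  le_ciSup (f := fun p : Fin N × Fin N => ‖x p.1 t - x p.2 t‖) (Set.finite_range _).bddAbove (i, j)

theorem maxDiscord_nonneg {N d : ℕ} (x : Fin N → ℝ → EuclideanSpace ℝ (Fin d)) (t : ℝ) :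
    0 ≤ maxDiscord x t :=
  Real.iSup_nonneg fun _ => norm_nonneg _

theorem maxDiscord_le {N d : ℕ} [NeZero N] {x : Fin N → ℝ → EuclideanSpace ℝ (Fin d)} {t R : ℝ}
    (h : ∀ i, ‖x i t‖ ≤ R) : maxDiscord x t ≤ 2 * R :=
  ciSup_le fun p => by linarith [norm_sub_le (x p.1 t) (x p.2 t), h p.1, h p.2]

theorem maxDiscord_le_add {N d : ℕ} [NeZero N] {x : Fin N → ℝ → EuclideanSpace ℝ (Fin d)}
    {t s δ : ℝ} (h : ∀ i, ‖x i t - x i s‖ ≤ δ) : maxDiscord x t ≤ maxDiscord x s + 2 * δ := by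
  refine ciSup_le fun p => ?_
  have e : x p.1 t - x p.2 t = (x p.1 s - x p.2 s) + ((x p.1 t - x p.1 s) - (x p.2 t - x p.2 s)) := by
    abel
  rw [e]
  linarith [norm_add_le (x p.1 s - x p.2 s) ((x p.1 t - x p.1 s) - (x p.2 t - x p.2 s)),
    norm_sub_le (x p.1 t - x p.1 s) (x p.2 t - x p.2 s), norm_sub_le_maxDiscord x s p.1 p.2,
    h p.1, h p.2]

/-- A bound `M` on the initial positions and velocities propagates: the positions `x` and the
anticipated positions `x + μ x'` of a transmission-delay system stay bounded by `(1 + μ) M`. -/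
theorem transmission_delay_norm_le {N : ℕ} {E : Type*} [NormedAddCommGroup E] [NormedSpace ℝ E]
    {τ μ M : ℝ} (hτ : 0 < τ) (hμ : 0 ≤ μ) (hμ1 : μ ≤ 1) {ψ : Fin N → Fin N → ℝ}
    (hψnonneg : ∀ i j : Fin N, 0 ≤ ψ i j)
    (hψstoch : ∀ i : Fin N, ∑ j ∈ Finset.univ.erase i, ψ i j = 1)
    {x xd : Fin N → ℝ → E}
    (hderiv : ∀ i, ∀ t ∈ Set.Ici (-τ), HasDerivWithinAt (x i) (xd i t) (Set.Ici (-τ)) t)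
    (hcont : ∀ i, ContinuousOn (xd i) (Set.Ici (-τ)))
    (hode : ∀ t > (0 : ℝ), ∀ i, xd i t =
      ∑ j ∈ Finset.univ.erase i, ψ i j • (x j (t - τ) + μ • xd j (t - τ) - x i t))
    (hM : ∀ i, ∀ t ∈ Set.Icc (-τ) 0, ‖x i t‖ ≤ M ∧ ‖xd i t‖ ≤ M) :
    ∀ i, ∀ t ≥ -τ, ‖x i t + μ • xd i t‖ ≤ (1 + μ) * M ∧ ‖x i t‖ ≤ (1 + μ) * M ∧
      (0 < t → ‖x i t + xd i t‖ ≤ (1 + μ) * M) := by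
  have step : ∀ n : ℕ, ∀ i, ∀ t ∈ Set.Icc (-τ) (n * τ), ‖x i t + μ • xd i t‖ ≤ (1 + μ) * M ∧
      ‖x i t‖ ≤ (1 + μ) * M ∧ (0 < t → ‖x i t + xd i t‖ ≤ (1 + μ) * M) := by
    intro n
    have base : ∀ i, ∀ t ∈ Set.Icc (-τ) 0, ‖x i t + μ • xd i t‖ ≤ (1 + μ) * M ∧
        ‖x i t‖ ≤ (1 + μ) * M ∧ (0 < t → ‖x i t + xd i t‖ ≤ (1 + μ) * M) := by
      intro i t ht
      obtain ⟨h1, h2⟩ := hM i t ht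
      have hM0 := (norm_nonneg _).trans h1
      have := norm_add_le (x i t) (μ • xd i t)
      rw [norm_smul, Real.norm_of_nonneg hμ] at this
      refine ⟨?_, ?_, fun h => absurd ht.2 (not_le.2 h)⟩ <;> nlinarith
    induction n with
    | zero => simpa using base
    | succ n ih =>
      intro i t ht
      rcases le_or_gt t 0 with h0 | h0
      · exact base i t ⟨ht.1, h0⟩
      have forcing : ∀ s ∈ Set.Ioc 0 t, ‖x i s + xd i s‖ ≤ (1 + μ) * M := by
        intro s hs
        have e : x i s + xd i s =
            ∑ j ∈ Finset.univ.erase i, ψ i j • (x j (s - τ) + μ • xd j (s - τ)) := by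
          rw [hode s hs.1 i]
          simp_rw [smul_sub _ _ (x i s)]
          rw [Finset.sum_sub_distrib, ← Finset.sum_smul, hψstoch i, one_smul]
          abel
        rw [e]
        refine norm_sum_smul_le_of_sum_eq_one (fun j _ => hψnonneg i j) (hψstoch i) fun j _ => ?_
        refine (ih j (s - τ) ⟨by linarith [hs.1], ?_⟩).1
        have := ht.2
        push_cast at this
        linarith [hs.2]
      have hsub : Set.Icc 0 t ⊆ Set.Ici (-τ) := fun s hs => by
        have := hs.1
        simp only [Set.mem_Ici]
        linarith
      have hx : ‖x i t‖ ≤ (1 + μ) * M := by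
        refine norm_le_of_norm_add_deriv_le h0.le (f' := xd i) (fun s hs => ?_)
          (fun s hs => ?_) ((hcont i).mono hsub) (base i 0 ⟨by linarith, le_rfl⟩).2.1 forcing
        · exact (hderiv i s (hsub hs)).mono (Set.Ici_subset_Ici.2 (hsub hs))
        · exact (hderiv i s (hsub hs)).continuousWithinAt.mono hsub
      have hsum := forcing t ⟨h0, le_rfl⟩
      refine ⟨?_, hx, fun _ => hsum⟩
      have e : x i t + μ • xd i t = (1 - μ) • x i t + μ • (x i t + xd i t) := by
        rw [sub_smul, one_smul, smul_add]
        abel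
      rw [e]
      exact mem_closedBall_zero_iff.1 (convex_closedBall (0 : E) _ (mem_closedBall_zero_iff.2 hx)
        (mem_closedBall_zero_iff.2 hsum) (by linarith) hμ (by ring))
  intro i t ht
  obtain ⟨n, hn⟩ := exists_nat_ge (t / τ)
  exact step n i t ⟨ht, (div_le_iff₀ hτ).1 hn⟩

/-- **Lipschitz continuity of the squared discord** for the transmission-type delay system:
`|d_x(t)² - d_x(s)²| ≤ 24 (1+λτ)² M² |t - s|` for all `t, s ≥ 0`. -/
theorem transmission_delay_discord_sq_lipschitz {N d : ℕ} (hN : 2 ≤ N) (hd : 1 ≤ d)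
    (τ lam : ℝ) (hτ : 0 < τ) (hlam : 0 ≤ lam) (hlamτ : lam * τ ≤ 1)
    (ψ : Fin N → Fin N → ℝ)
    (hψnonneg : ∀ i j : Fin N, 0 ≤ ψ i j)
    (hψstoch : ∀ i : Fin N, ∑ j ∈ Finset.univ.erase i, ψ i j = 1)
    (x xd : Fin N → ℝ → EuclideanSpace ℝ (Fin d))
    (hderiv : ∀ i, ∀ t ∈ Set.Ici (-τ), HasDerivWithinAt (x i) (xd i t) (Set.Ici (-τ)) t)
    (hcont : ∀ i, ContinuousOn (xd i) (Set.Ici (-τ)))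
    (hode : ∀ t > (0 : ℝ), ∀ i, xd i t =
      ∑ j ∈ Finset.univ.erase i, ψ i j • (x j (t - τ) + (lam * τ) • xd j (t - τ) - x i t))
    (M : ℝ)
    (hM : M = ⨆ i : Fin N, ⨆ t : Set.Icc (-τ) (0 : ℝ), max ‖x i t‖ ‖xd i t‖) :
    ∀ t ≥ (0 : ℝ), ∀ s ≥ (0 : ℝ),
      |(maxDiscord x t) ^ 2 - (maxDiscord x s) ^ 2| ≤
        24 * (1 + lam * τ) ^ 2 * M ^ 2 * |t - s| := by
  have : NeZero N := ⟨by omega⟩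
  have hμ : 0 ≤ lam * τ := mul_nonneg hlam hτ.le
  have hMle : ∀ i, ∀ t ∈ Set.Icc (-τ) 0, ‖x i t‖ ≤ M ∧ ‖xd i t‖ ≤ M := by
    intro i t ht
    have hc : ContinuousOn (fun s => max ‖x i s‖ ‖xd i s‖) (Set.Icc (-τ) 0) :=
      ContinuousOn.sup (ContinuousOn.norm fun s hs => (hderiv i s hs.1).continuousWithinAt.mono
        Set.Icc_subset_Ici_self) ((hcont i).mono Set.Icc_subset_Ici_self).norm
    have hb := isCompact_Icc.bddAbove_image hc
    rw [Set.image_eq_range] at hb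
    rw [← max_le_iff, hM]
    exact (le_ciSup (f := fun s : Set.Icc (-τ) (0 : ℝ) => max ‖x i s‖ ‖xd i s‖) hb ⟨t, ht⟩).trans
      (le_ciSup (f := fun k => ⨆ s : Set.Icc (-τ) (0 : ℝ), max ‖x k s‖ ‖xd k s‖)
        (Set.finite_range _).bddAbove i)
  have hbound := transmission_delay_norm_le hτ hμ hlamτ hψnonneg hψstoch hderiv hcont hode hMle
  set R := (1 + lam * τ) * M with hR
  have hsub : Set.Ici (0 : ℝ) ⊆ Set.Ici (-τ) := Set.Ici_subset_Ici.2 (by linarith)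
  have hx : ∀ i, ∀ t ≥ (0 : ℝ), ‖x i t‖ ≤ R := fun i t ht => (hbound i t (hsub ht)).2.1
  have hxd : ∀ i, ∀ t ∈ Set.Ici (0 : ℝ), ‖xd i t‖ ≤ 2 * R := by
    intro i t ht
    rcases (Set.mem_Ici.1 ht).eq_or_lt with rfl | h0
    · have h := (hMle i 0 ⟨by linarith, le_rfl⟩).2
      nlinarith [norm_nonneg (xd i 0)]
    · have h := norm_sub_le (x i t + xd i t) (x i t)
      rw [add_sub_cancel_left] at h
      linarith [hx i t ht, (hbound i t (hsub ht)).2.2 h0]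
  have hLip : ∀ t ≥ (0 : ℝ), ∀ s ≥ (0 : ℝ),
      maxDiscord x t ≤ maxDiscord x s + 2 * (2 * R * |t - s|) := fun t ht s hs =>
    maxDiscord_le_add fun i => (convex_Ici (0 : ℝ)).norm_image_sub_le_of_norm_hasDerivWithin_le
      (fun r hr => (hderiv i r (hsub hr)).mono hsub) (hxd i) hs ht
  intro t ht s hs
  have hdiff : |maxDiscord x t - maxDiscord x s| ≤ 4 * R * |t - s| := by
    have h1 := hLip t ht s hs
    have h2 := hLip s hs t ht
    rw [abs_sub_comm s t] at h2
    rw [abs_le]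
    constructor <;> linarith
  have hsum : maxDiscord x t + maxDiscord x s ≤ 4 * R := by
    linarith [maxDiscord_le fun i => hx i t ht, maxDiscord_le fun i => hx i s hs]
  have hsum0 := add_nonneg (maxDiscord_nonneg x t) (maxDiscord_nonneg x s)
  calc |(maxDiscord x t) ^ 2 - (maxDiscord x s) ^ 2|
      = (maxDiscord x t + maxDiscord x s) * |maxDiscord x t - maxDiscord x s| := by
        rw [sq_sub_sq, abs_mul, abs_of_nonneg hsum0]
    _ ≤ (4 * R) * (4 * R * |t - s|) :=
        mul_le_mul hsum hdiff (abs_nonneg _) (hsum0.trans hsum)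
    _ ≤ 24 * R ^ 2 * |t - s| := by
        nlinarith [mul_nonneg (sq_nonneg R) (abs_nonneg (t - s))]
    _ = 24 * (1 + lam * τ) ^ 2 * M ^ 2 * |t - s| := by rw [hR]; ring
end
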